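/- Let a_1,…,a_n be positive integers with Σ_{i=1}^n a_i = 2C, and suppose some feasible solution to DLSPp has cost at most n + C. Then every optimal solution (x*, y*) of DLSPp satisfies, for each period i = 1,…,n: either x*_i = a_i and y*_i = 0, or x*_i = 0 and y*_i = a_i; moreover the set A = { i : x*_i > 0 } satisfies Σ_{i∈A} a_i = C. -/

import Mathlib

/-- Core level `J i` determined by returns `R` and remanufacturing decisions `x`:
`J 1 = R 1`, `J (i+1) = J i + R (i+1) - x i`. -/
def coreLevel (R x : ℕ → ℤ) : ℕ → ℤ
  | 0 => 0
  | 1 => R 1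
  | (i + 2) => coreLevel R x (i + 1) + R (i + 2) - x (i + 1)

/-- Serviceable inventory level `I i`: `I 1 = 0`, `I (i+1) = I i + x i + y i - D i`. -/
def servLevel (D x y : ℕ → ℤ) : ℕ → ℤ
  | 0 => 0
  | 1 => 0
  | (i + 2) => servLevel D x y (i + 1) + x (i + 1) + y (i + 1) - D (i + 1)

/-- Feasibility of `(x, y)` for the dynamic lot sizing problem with `N` periods,
demands `D` and returns `R`. -/
def Feasible (N : ℕ) (D R x y : ℕ → ℤ) : Prop :=
  ∀ i : ℕ, 1 ≤ i → i ≤ N →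
    0 ≤ x i ∧ 0 ≤ y i ∧ x i ≤ coreLevel R x i ∧ 0 ≤ servLevel D x y (i + 1)

/-- Total cost of a solution `(x, y)` of the dynamic lot sizing problem. -/
def cost (N : ℕ) (D R Kr Km hs hc cr cm x y : ℕ → ℤ) : ℤ :=
  ∑ i ∈ Finset.Icc 1 N,
    (Kr i * (if 0 < x i then 1 else 0) + Km i * (if 0 < y i then 1 else 0)
      + cr i * x i + cm i * y i + hc i * (coreLevel R x i - x i)
      + hs i * servLevel D x y (i + 1))

/-- Returns for the DLSPp instance: `R 1 = C`, `R i = 0` for `i ≠ 1`. -/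
def ppR (C : ℤ) : ℕ → ℤ := fun i => if i = 1 then C else 0

theorem coreLevel_ppR_succ (C : ℤ) (x : ℕ → ℤ) (m : ℕ) :
    coreLevel (ppR C) x (m + 1) = C - ∑ i ∈ Finset.Icc 1 m, x i := by
  induction m with
  | zero => simp [coreLevel, ppR]
  | succ k ih =>
    rw [Finset.sum_Icc_succ_top (by omega), coreLevel, ih]
    simp [ppR]
    ring

theorem servLevel_succ (D x y : ℕ → ℤ) {i : ℕ} (hi : 1 ≤ i) :
    servLevel D x y (i + 1) = servLevel D x y i + x i + y i - D i := by
  obtain ⟨k, rfl⟩ := Nat.exists_eq_add_of_le' hi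
  rfl

theorem servLevel_eq_sum (D x y : ℕ → ℤ) (m : ℕ) :
    servLevel D x y (m + 1) = ∑ i ∈ Finset.Icc 1 m, (x i + y i - D i) := by
  induction m with
  | zero => simp [servLevel]
  | succ k ih =>
    rw [Finset.sum_Icc_succ_top (by omega), servLevel, ih]
    ring

theorem Feasible.servLevel_nonneg {N : ℕ} {D R x y : ℕ → ℤ} (h : Feasible N D R x y)
    {i : ℕ} (hi : i ≤ N + 1) : 0 ≤ servLevel D x y i := by
  match i with
  | 0 => exact le_rfl
  | 1 => exact le_rfl
  | k + 2 => exact (h (k + 1) (by omega) (by omega)).2.2.2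

theorem Feasible.sum_reman_le {n : ℕ} {a x y : ℕ → ℤ} {C : ℤ} (hn : 1 ≤ n)
    (h : Feasible n a (ppR C) x y) : ∑ i ∈ Finset.Icc 1 n, x i ≤ C := by
  obtain ⟨k, rfl⟩ := Nat.exists_eq_add_of_le' hn
  have hk := (h (k + 1) (by omega) le_rfl).2.2.1
  rw [coreLevel_ppR_succ] at hk
  rw [Finset.sum_Icc_succ_top (by omega)]
  linarith

/-- The excess of the setup and holding cost of period `i` over one setup, after the holding cost
has been shared with the following period. -/
def excess (a x y : ℕ → ℤ) (i : ℕ) : ℤ :=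
  (if 0 < x i then 1 else 0) + (if 0 < y i then 1 else 0) + servLevel a x y i - 1
    + 2 * servLevel a x y (i + 1)

theorem Feasible.excess_nonneg {n : ℕ} {a R x y : ℕ → ℤ}
    (ha : ∀ i : ℕ, 1 ≤ i → i ≤ n → 0 < a i) (h : Feasible n a R x y)
    {i : ℕ} (h1 : 1 ≤ i) (hi : i ≤ n) : 0 ≤ excess a x y i := by
  obtain ⟨hx, hy, -, hI⟩ := h i h1 hi
  have hI' := h.servLevel_nonneg (i := i) (by omega)
  have hs := servLevel_succ a x y h1
  have hai := ha i h1 hi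
  unfold excess
  split_ifs <;> omega

theorem cost_ppR_eq (n : ℕ) (a x y : ℕ → ℤ) (C : ℤ) :
    cost n a (ppR C) (fun _ => 1) (fun _ => 1) (fun _ => 3) (fun _ => 0)
      (fun _ => 0) (fun _ => 1) x y =
    n + servLevel a x y (n + 1) + ∑ i ∈ Finset.Icc 1 n, y i
      + ∑ i ∈ Finset.Icc 1 n, excess a x y i := by
  have hcard : (n : ℤ) = ∑ i ∈ Finset.Icc 1 n, 1 := by simp
  rw [servLevel_eq_sum, hcard, ← Finset.sum_add_distrib, ← Finset.sum_add_distrib,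
    ← Finset.sum_add_distrib]
  refine Finset.sum_congr rfl fun i hi => ?_
  have hs := servLevel_succ a x y (Finset.mem_Icc.1 hi).1
  unfold excess
  linarith

/-- If some feasible solution to DLSPp has cost at most `n + C`, then every optimal
solution remanufactures exactly `a i` or manufactures exactly `a i` in each period,
and the set of remanufacturing periods is a solution to the partition instance. -/
theorem stmt12 (n : ℕ) (hn : 1 ≤ n) (a : ℕ → ℤ) (C : ℤ)
    (ha : ∀ i : ℕ, 1 ≤ i → i ≤ n → 0 < a i)
    (hsum : ∑ i ∈ Finset.Icc 1 n, a i = 2 * C)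
    (hcheap : ∃ x y : ℕ → ℤ, Feasible n a (ppR C) x y ∧
      cost n a (ppR C) (fun _ => 1) (fun _ => 1) (fun _ => 3) (fun _ => 0)
        (fun _ => 0) (fun _ => 1) x y ≤ (n : ℤ) + C)
    (x y : ℕ → ℤ)
    (hfeas : Feasible n a (ppR C) x y)
    (hopt : ∀ x' y' : ℕ → ℤ, Feasible n a (ppR C) x' y' →
      cost n a (ppR C) (fun _ => 1) (fun _ => 1) (fun _ => 3) (fun _ => 0)
          (fun _ => 0) (fun _ => 1) x y ≤
        cost n a (ppR C) (fun _ => 1) (fun _ => 1) (fun _ => 3) (fun _ => 0)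
          (fun _ => 0) (fun _ => 1) x' y') :
    (∀ i : ℕ, 1 ≤ i → i ≤ n → (x i = a i ∧ y i = 0) ∨ (x i = 0 ∧ y i = a i)) ∧
    ∑ i ∈ (Finset.Icc 1 n).filter (fun i => 0 < x i), a i = C := by
  obtain ⟨x', y', hfeas', hcost'⟩ := hcheap
  have hcost := (hopt x' y' hfeas').trans hcost'
  rw [cost_ppR_eq] at hcost
  have hx := hfeas.sum_reman_le hn
  have hI := hfeas.servLevel_nonneg (le_refl (n + 1))
  have hbal := servLevel_eq_sum a x y n
  rw [Finset.sum_sub_distrib, Finset.sum_add_distrib, hsum] at hbal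
  have hnonneg : ∀ i ∈ Finset.Icc 1 n, 0 ≤ excess a x y i := fun i hi =>
    hfeas.excess_nonneg ha (Finset.mem_Icc.1 hi).1 (Finset.mem_Icc.1 hi).2
  have hsum_nonneg := Finset.sum_nonneg hnonneg
  have hsum_zero : ∑ i ∈ Finset.Icc 1 n, excess a x y i = 0 := by linarith
  have hzero := (Finset.sum_eq_zero_iff_of_nonneg hnonneg).1 hsum_zero
  have hperiod : ∀ i : ℕ, 1 ≤ i → i ≤ n →
      (x i = a i ∧ y i = 0) ∨ (x i = 0 ∧ y i = a i) := by
    intro i h1 hi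
    have hz := hzero i (Finset.mem_Icc.2 ⟨h1, hi⟩)
    have hai := ha i h1 hi
    have hs := servLevel_succ a x y h1
    have hprev : servLevel a x y i = 0 := by
      obtain ⟨k, rfl⟩ := Nat.exists_eq_add_of_le' h1
      rcases Nat.eq_zero_or_pos k with rfl | hk
      · rfl
      · have hz' := hzero k (Finset.mem_Icc.2 ⟨hk, by omega⟩)
        have hs' := servLevel_succ a x y hk
        have hI' := hfeas.servLevel_nonneg (i := k) (by omega)
        obtain ⟨hxk, hyk, -, hIk⟩ := hfeas k hk (by omega)
        have hak := ha k hk (by omega)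
        unfold excess at hz'
        split_ifs at hz' <;> omega
    obtain ⟨hxi, hyi, -, hIi⟩ := hfeas i h1 hi
    unfold excess at hz
    split_ifs at hz <;> omega
  refine ⟨hperiod, ?_⟩
  have hfilter : ∑ i ∈ (Finset.Icc 1 n).filter (fun i => 0 < x i), a i =
      ∑ i ∈ Finset.Icc 1 n, x i := by
    rw [Finset.sum_filter]
    refine Finset.sum_congr rfl fun i hi => ?_
    obtain ⟨h1, hin⟩ := Finset.mem_Icc.1 hi
    have hai := ha i h1 hin
    have hi' := hperiod i h1 hin
    split_ifs <;> omega
  linarith
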